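/- Suppose ε is smooth with ∇·(εE) = 0 and E solves ε ∂ₜₜE + ∇×∇×E = 0 in a bounded domain Ω with E = 0 on ∂Ω. Then for all t, the energy identity d/dt [ ½‖√ε ∂ₜE‖² + ½‖∇E‖² + ½‖√(ε−1) ∇·E‖² ] + (∇ε · E, ∇·∂ₜE) = 0 holds, where ‖·‖ is the L²(Ω) norm. -/

import Mathlib

open scoped BigOperators
open MeasureTheory

noncomputable def pd3 (i : Fin 3) (f : (Fin 3 → ℝ) → ℝ) (x : Fin 3 → ℝ) : ℝ :=
  fderiv ℝ f x (Pi.single i 1)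

noncomputable def curl3 (E : (Fin 3 → ℝ) → (Fin 3 → ℝ)) (x : Fin 3 → ℝ) : Fin 3 → ℝ :=
  fun i => pd3 (i + 1) (fun y => E y (i + 2)) x - pd3 (i + 2) (fun y => E y (i + 1)) x

noncomputable def div3 (E : (Fin 3 → ℝ) → (Fin 3 → ℝ)) (x : Fin 3 → ℝ) : ℝ :=
  ∑ i, pd3 i (fun y => E y i) x

/-- Time derivative of a time dependent vector field. -/
noncomputable def dt3 (E : ℝ → (Fin 3 → ℝ) → (Fin 3 → ℝ)) (t : ℝ) (x : Fin 3 → ℝ) :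
    Fin 3 → ℝ :=
  fun i => deriv (fun s => E s x i) t

section BoundaryVanishing

open Set Filter Topology

/-- The zeros of a real function at which the derivative does not vanish are isolated. -/
theorem countable_setOf_eq_zero_deriv_ne_zero {g g' : ℝ → ℝ} (hg : ∀ t, HasDerivAt g (g' t) t) :
    {t | g t = 0 ∧ g' t ≠ 0}.Countable := by
  refine Countable.mono (fun t ht => ?_) (countable_setOfPred_isolated_right_within
    (s := {t | g t = 0 ∧ g' t ≠ 0}))
  refine ⟨ht, ?_⟩
  have h := (hg t).eventually_ne (c := 0) ht.2
  rw [← Filter.empty_mem_iff_bot]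
  have h' : ∀ᶠ z in 𝓝[{t | g t = 0 ∧ g' t ≠ 0} ∩ Ioi t] t, g z ≠ 0 :=
    h.filter_mono (nhdsWithin_mono _ fun z hz => ne_of_gt hz.2)
  filter_upwards [h', self_mem_nhdsWithin] with z hz hz'
  exact hz hz'.1.1

/-- For continuous functions, equality on an arbitrary set, measurable or not, suffices. -/
theorem setIntegral_congr_of_continuous {X : Type*} [TopologicalSpace X] [MeasurableSpace X]
    [BorelSpace X] {μ : Measure X} {Ω : Set X} {f g : X → ℝ} (hf : Continuous f) (hg : Continuous g)
    (h : EqOn f g Ω) : ∫ x in Ω, f x ∂μ = ∫ x in Ω, g x ∂μ :=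
  integral_congr_ae <| (ae_restrict_iff
    (measurableSet_eq_fun hf.measurable hg.measurable)).2 (.of_forall h)

variable {V : Type*} [NormedAddCommGroup V] [NormedSpace ℝ V]

theorem hasLineDerivAt_indicator_of_eq_zero {Ω : Set V} {w : V → ℝ} {x v : V}
    (hw : HasLineDerivAt ℝ w 0 x v) (hx : w x = 0) :
    HasLineDerivAt ℝ (Ω.indicator w) 0 x v := by
  unfold HasLineDerivAt at *
  rw [hasDerivAt_iff_isLittleO_nhds_zero] at *
  refine Asymptotics.IsBigO.trans_isLittleO (.of_bound 1 (.of_forall fun t => ?_)) hw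
  have hx' : Ω.indicator w x = 0 := by by_cases h : x ∈ Ω <;> simp [h, hx]
  simp only [zero_add, zero_smul, add_zero, hx, hx', smul_zero, sub_zero, one_mul]
  exact norm_indicator_le_norm_self _ _

variable [FiniteDimensional ℝ V]

theorem exists_lipschitzWith_indicator {Ω : Set V} (hΩ : Bornology.IsBounded Ω) {w : V → ℝ}
    (hw : ContDiff ℝ 1 w) (h0 : ∀ x ∈ frontier Ω, w x = 0) :
    ∃ C, LipschitzWith C (Ω.indicator w) := by
  obtain ⟨C, hC⟩ := (hw.locallyLipschitz.locallyLipschitzOn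
    (s := closure Ω)).exists_lipschitzOnWith_of_compact hΩ.isCompact_closure
  have key : ∀ x ∈ Ω, ∀ y ∉ Ω, |w x| ≤ C * dist x y := by
    intro x hx y hy
    obtain ⟨z, hz, hd⟩ := exists_mem_frontier_infDist_compl_eq_dist hx
      (fun h => hy (h ▸ mem_univ y))
    have h1 := hC.dist_le_mul x (subset_closure hx) z (frontier_subset_closure hz)
    rw [h0 z hz, Real.dist_eq, sub_zero] at h1
    exact h1.trans (mul_le_mul_of_nonneg_left
      (hd ▸ Metric.infDist_le_dist_of_mem (show y ∈ Ωᶜ from hy)) C.2)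
  refine ⟨C, LipschitzWith.of_dist_le_mul fun x y => ?_⟩
  by_cases hx : x ∈ Ω <;> by_cases hy : y ∈ Ω
  · simpa [hx, hy] using hC.dist_le_mul x (subset_closure hx) y (subset_closure hy)
  · simpa [hx, hy, Real.dist_eq] using key x hx y hy
  · simpa [hx, hy, Real.dist_eq, dist_comm x y] using key y hy x hx
  · simp [hx, hy]; positivity

variable [MeasurableSpace V] [BorelSpace V] {μ : Measure V} [μ.IsAddHaarMeasure]

theorem ae_fderiv_apply_eq_zero_of_eq_zero {w : V → ℝ} (hw : ContDiff ℝ 1 w) (v : V) :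
    ∀ᵐ x ∂μ, w x = 0 → fderiv ℝ w x v = 0 := by
  let L : ℝ →L[ℝ] V := ContinuousLinearMap.smulRight (1 : ℝ →L[ℝ] ℝ) v
  have hc : Continuous fun x => fderiv ℝ w x v :=
    (hw.continuous_fderiv one_ne_zero).clm_apply continuous_const
  have hm : MeasurableSet {x | w x = 0 → fderiv ℝ w x v = 0} :=
    (measurableSet_eq_fun hw.continuous.measurable measurable_const).imp
      (measurableSet_eq_fun hc.measurable measurable_const)
  refine ae_mem_of_ae_add_linearMap_mem L.toLinearMap volume μ hm fun y => ?_
  have hg : ∀ t : ℝ, HasDerivAt (fun s : ℝ => w (y + s • v)) (fderiv ℝ w (y + t • v) v) t := by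
    intro t
    have h1 : HasDerivAt (fun s : ℝ => y + s • v) v t := by
      simpa using ((hasDerivAt_id t).smul_const v).const_add y
    exact ((hw.differentiable one_ne_zero _).hasFDerivAt).comp_hasDerivAt t h1
  filter_upwards [(countable_setOf_eq_zero_deriv_ne_zero hg).ae_notMem volume] with t ht h0
  by_contra hne
  exact ht ⟨by simpa [L] using h0, by simpa [L] using hne⟩

/-- No regularity (not even measurability) of the bounded set `Ω` is needed, because
`w` vanishes on the whole of `frontier Ω`. -/
theorem setIntegral_fderiv_apply_eq_zero {Ω : Set V} (hΩ : Bornology.IsBounded Ω) {w : V → ℝ}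
    (hw : ContDiff ℝ 1 w) (h0 : ∀ x ∈ frontier Ω, w x = 0) (v : V) :
    ∫ x in Ω, fderiv ℝ w x v ∂μ = 0 := by
  obtain ⟨C, hC⟩ := exists_lipschitzWith_indicator hΩ hw h0
  have hsupp : HasCompactSupport (Ω.indicator w) :=
    HasCompactSupport.of_support_subset_isCompact hΩ.isCompact_closure
      (support_indicator_subset.trans subset_closure)
  have hdiff : ∀ x, HasLineDerivAt ℝ w (fderiv ℝ w x v) x v := fun x =>
    (hw.differentiable one_ne_zero x).hasFDerivAt.hasLineDerivAt v
  have hae := ae_fderiv_apply_eq_zero_of_eq_zero (μ := μ) hw v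
  have hline : ∀ᵐ x ∂μ, lineDeriv ℝ (Ω.indicator w) x v =
      (interior Ω).indicator (fun y => fderiv ℝ w y v) x := by
    filter_upwards [hae] with x hx
    by_cases hi : x ∈ interior Ω
    · rw [indicator_of_mem hi]
      refine ((hdiff x).congr_of_eventuallyEq ?_).lineDeriv
      filter_upwards [mem_interior_iff_mem_nhds.1 hi] with y hy
      simp [hy]
    rw [indicator_of_notMem hi]
    by_cases hc : x ∈ closure Ω
    · have hwx := h0 x ⟨hc, hi⟩
      exact (hasLineDerivAt_indicator_of_eq_zero (hx hwx ▸ hdiff x) hwx).lineDeriv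
    · have h : HasLineDerivAt ℝ (fun _ : V => (0 : ℝ)) 0 x v := by
        simpa using! (hasFDerivAt_const (𝕜 := ℝ) (0 : ℝ) x).hasLineDerivAt v
      refine (h.congr_of_eventuallyEq ?_).lineDeriv
      filter_upwards [isClosed_closure.isOpen_compl.mem_nhds hc] with y hy
      rw [indicator_of_notMem fun hy' => hy (subset_closure hy')]
  have hzero : ∫ x, lineDeriv ℝ (Ω.indicator w) x v ∂μ = 0 := by
    have h := LipschitzWith.integral_lineDeriv_mul_eq (μ := μ) (LipschitzWith.const (1 : ℝ)) hC hsupp (-v)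
    simpa [lineDeriv] using h.symm
  rw [integral_congr_ae hline, integral_indicator isOpen_interior.measurableSet] at hzero
  have hmem : ∀ᵐ x ∂μ.restrict Ω, x ∈ closure Ω :=
    ae_mono (Measure.restrict_mono subset_closure le_rfl)
      (ae_restrict_mem isClosed_closure.measurableSet)
  have hind : (fun x => fderiv ℝ w x v) =ᵐ[μ.restrict Ω]
      (interior Ω).indicator fun x => fderiv ℝ w x v := by
    filter_upwards [hmem, ae_restrict_of_ae hae] with x hx hx'
    by_cases hi : x ∈ interior Ω
    · rw [indicator_of_mem hi]
    · rw [indicator_of_notMem hi, hx' (h0 x ⟨hx, hi⟩)]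
  rw [integral_congr_ae hind, setIntegral_indicator isOpen_interior.measurableSet,
    inter_eq_right.2 interior_subset, hzero]

theorem integrableOn_of_continuous_of_isBounded {Ω : Set V} (hΩ : Bornology.IsBounded Ω)
    {f : V → ℝ} (hf : Continuous f) : IntegrableOn f Ω μ :=
  (hf.continuousOn.integrableOn_compact hΩ.isCompact_closure).mono_set subset_closure

theorem hasDerivAt_setIntegral_of_continuous {Ω : Set V} (hΩ : Bornology.IsBounded Ω)
    {F F' : ℝ → V → ℝ} (hF : ∀ t, Continuous (F t))
    (hF' : Continuous fun p : ℝ × V => F' p.1 p.2)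
    (hd : ∀ t x, HasDerivAt (fun s => F s x) (F' t x) t) (t : ℝ) :
    HasDerivAt (fun s => ∫ x in Ω, F s x ∂μ) (∫ x in Ω, F' t x ∂μ) t := by
  obtain ⟨C, hC⟩ := ((isCompact_closedBall t 1).prod
    hΩ.isCompact_closure).exists_bound_of_continuousOn hF'.continuousOn
  have hmem : ∀ᵐ x ∂μ.restrict Ω, x ∈ closure Ω :=
    ae_mono (Measure.restrict_mono subset_closure le_rfl)
      (ae_restrict_mem isClosed_closure.measurableSet)
  have hF't : Continuous (F' t) := hF'.comp (by fun_prop : Continuous fun x : V => (t, x))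
  refine (hasDerivAt_integral_of_dominated_loc_of_deriv_le (bound := fun _ => C)
    (Metric.closedBall_mem_nhds t one_pos)
    (.of_forall fun s => (hF s).aestronglyMeasurable)
    (integrableOn_of_continuous_of_isBounded hΩ (hF t)) hF't.aestronglyMeasurable ?_
    (integrableOn_of_continuous_of_isBounded hΩ continuous_const)
    (.of_forall fun x s _ => hd s x)).2
  filter_upwards [hmem] with x hx s hs using hC (s, x) ⟨hs, hx⟩

end BoundaryVanishing

section DirectionalDerivative

variable {W : Type*} [NormedAddCommGroup W] [NormedSpace ℝ W]

/-- The derivative of `g` in the constant direction `u`. -/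
noncomputable def dirD (u : W) (g : W → ℝ) (p : W) : ℝ := fderiv ℝ g p u

theorem ContDiff.dirD {m n : WithTop ℕ∞} {g : W → ℝ} (hg : ContDiff ℝ n g) (hmn : m + 1 ≤ n)
    (u : W) : ContDiff ℝ m (dirD u g) :=
  (hg.fderiv_right hmn).clm_apply contDiff_const

theorem dirD_comm {g : W → ℝ} (hg : ContDiff ℝ 2 g) (u v : W) (p : W) :
    dirD u (dirD v g) p = dirD v (dirD u g) p := by
  have hd : DifferentiableAt ℝ (fderiv ℝ g) p :=
    (hg.fderiv_right (m := 1) (by norm_num)).differentiable one_ne_zero p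
  have key : ∀ a b : W, dirD a (dirD b g) p = fderiv ℝ (fderiv ℝ g) p a b := by
    intro a b
    unfold dirD
    rw [fderiv_clm_apply hd (differentiableAt_const b)]
    simp
  rw [key, key]
  exact hg.contDiffAt.isSymmSndFDerivAt (by simp) u v

theorem dirD_sub {g h : W → ℝ} {p : W} (hg : DifferentiableAt ℝ g p)
    (hh : DifferentiableAt ℝ h p) (u : W) :
    dirD u (fun q => g q - h q) p = dirD u g p - dirD u h p := by
  simp [dirD, fderiv_fun_sub hg hh]

theorem dirD_mul {g h : W → ℝ} {p : W} (hg : DifferentiableAt ℝ g p)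
    (hh : DifferentiableAt ℝ h p) (u : W) :
    dirD u (fun q => g q * h q) p = dirD u g p * h p + g p * dirD u h p := by
  simp [dirD, fderiv_fun_mul hg hh]; ring

theorem dirD_sum {ι : Type*} {s : Finset ι} {g : ι → W → ℝ} {p : W}
    (hg : ∀ i ∈ s, DifferentiableAt ℝ (g i) p) (u : W) :
    dirD u (fun q => ∑ i ∈ s, g i q) p = ∑ i ∈ s, dirD u (g i) p := by
  simp [dirD, fderiv_fun_sum hg]

end DirectionalDerivative

section SpaceTime

/-- The time direction of space-time. -/
def timeDir : ℝ × (Fin 3 → ℝ) := (1, 0)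

/-- The `i`-th spatial direction of space-time. -/
def spaceDir (i : Fin 3) : ℝ × (Fin 3 → ℝ) := (0, Pi.single i 1)

variable {g : ℝ × (Fin 3 → ℝ) → ℝ}

theorem hasDerivAt_time (hg : Differentiable ℝ g) (t : ℝ) (x : Fin 3 → ℝ) :
    HasDerivAt (fun s => g (s, x)) (dirD timeDir g (t, x)) t :=
  (hg (t, x)).hasFDerivAt.comp_hasDerivAt t ((hasDerivAt_id t).prodMk (hasDerivAt_const t x))

theorem fderiv_space (hg : Differentiable ℝ g) (t : ℝ) (x v : Fin 3 → ℝ) :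
    fderiv ℝ (fun y => g (t, y)) x v = dirD (0, v) g (t, x) := by
  have h := (hg (t, x)).hasFDerivAt.comp x ((hasFDerivAt_const t x).prodMk (hasFDerivAt_id x))
  have h' : HasFDerivAt (fun y => g (t, y)) _ x := h
  rw [h'.fderiv]
  simp [dirD]

theorem pd3_slice (hg : Differentiable ℝ g) (t : ℝ) (x : Fin 3 → ℝ) (i : Fin 3) :
    pd3 i (fun y => g (t, y)) x = dirD (spaceDir i) g (t, x) :=
  fderiv_space hg t x _

end SpaceTime

section Maxwell

variable {f : Fin 3 → ℝ × (Fin 3 → ℝ) → ℝ}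

/-- The energy flux in direction `j`, for the space-time field with components `f i`. -/
noncomputable def energyFlux (f : Fin 3 → ℝ × (Fin 3 → ℝ) → ℝ) (j : Fin 3)
    (p : ℝ × (Fin 3 → ℝ)) : ℝ :=
  ∑ i, dirD timeDir (f i) p * dirD (spaceDir j) (f i) p
    - dirD timeDir (f j) p * ∑ i, dirD (spaceDir i) (f i) p

theorem contDiff_energyFlux (hf : ∀ i, ContDiff ℝ 3 (f i)) (j : Fin 3) :
    ContDiff ℝ 1 (energyFlux f j) := by
  have h1 : ∀ u i, ContDiff ℝ 1 (dirD u (f i)) := fun u i => (hf i).dirD (by norm_num) u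
  unfold energyFlux
  fun_prop

theorem dirD_energyFlux (hf : ∀ i, ContDiff ℝ 3 (f i)) (u : ℝ × (Fin 3 → ℝ)) (j : Fin 3)
    (p : ℝ × (Fin 3 → ℝ)) :
    dirD u (energyFlux f j) p =
      ∑ i, (dirD u (dirD timeDir (f i)) p * dirD (spaceDir j) (f i) p
        + dirD timeDir (f i) p * dirD u (dirD (spaceDir j) (f i)) p)
      - (dirD u (dirD timeDir (f j)) p * ∑ i, dirD (spaceDir i) (f i) p
        + dirD timeDir (f j) p * ∑ i, dirD u (dirD (spaceDir i) (f i)) p) := by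
  have h1 : ∀ v i, DifferentiableAt ℝ (dirD v (f i)) p := fun v i =>
    ((hf i).dirD (m := 2) (by norm_num) v).differentiable two_ne_zero p
  unfold energyFlux
  rw [dirD_sub (by fun_prop) (by fun_prop), dirD_mul (by fun_prop) (by fun_prop),
    dirD_sum (by fun_prop), dirD_sum (by fun_prop)]
  simp only [dirD_mul (h1 _ _) (h1 _ _)]

end Maxwell

/-- Energy identity: if `ε` is smooth, `∇·(εE) = 0`, and `E` solves
`ε ∂ₜₜE + ∇×∇×E = 0` in `Ω` with `E = 0` on `∂Ω`, then
`d/dt [½‖√ε ∂ₜE‖² + ½‖∇E‖² + ½‖√(ε−1) ∇·E‖²] + (∇ε·E, ∇·∂ₜE) = 0`. -/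
theorem energy_identity (Ω : Set (Fin 3 → ℝ)) (hΩ : Bornology.IsBounded Ω)
    (ε : (Fin 3 → ℝ) → ℝ) (hεsm : ContDiff ℝ 2 ε) (hε1 : ∀ x, 1 ≤ ε x)
    (E : ℝ → (Fin 3 → ℝ) → (Fin 3 → ℝ))
    (hEsm : ContDiff ℝ 3 fun p : ℝ × (Fin 3 → ℝ) => E p.1 p.2)
    (hPDE : ∀ t, ∀ x ∈ Ω, ∀ i,
      ε x * deriv (fun s => dt3 E s x i) t + curl3 (fun y => curl3 (E t) y) x i = 0)
    (hBC : ∀ t, ∀ x ∈ frontier Ω, E t x = 0)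
    (hdiv : ∀ t, ∀ x ∈ Ω, div3 (fun y => ε y • E t y) x = 0) :
    ∀ t, HasDerivAt
      (fun s => ∫ x in Ω,
        ((ε x * ∑ i, (dt3 E s x i) ^ 2) / 2
          + (∑ i, ∑ j, (pd3 j (fun y => E s y i) x) ^ 2) / 2
          + ((ε x - 1) * (div3 (E s) x) ^ 2) / 2))
      (-(∫ x in Ω, (∑ i, pd3 i ε x * E t x i) * div3 (fun y => dt3 E t y) x)) t := by
  intro t
  let f : Fin 3 → ℝ × (Fin 3 → ℝ) → ℝ := fun i p => E p.1 p.2 i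
  have hf : ∀ i, ContDiff ℝ 3 (f i) := fun i => contDiff_pi.1 hEsm i
  have hf0 : ∀ i, Differentiable ℝ (f i) := fun i => (hf i).differentiable three_ne_zero
  have hf1 : ∀ u i, ContDiff ℝ 2 (dirD u (f i)) := fun u i => (hf i).dirD (by norm_num) u
  have hf1' : ∀ u i, Differentiable ℝ (dirD u (f i)) := fun u i =>
    (hf1 u i).differentiable two_ne_zero
  have hf1c : ∀ u i, Continuous (dirD u (f i)) := fun u i => (hf1 u i).continuous
  have hf2c : ∀ u v i, Continuous (dirD u (dirD v (f i))) := fun u v i =>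
    ((hf1 v i).dirD (m := 1) (by norm_num) u).continuous
  have hcomm : ∀ u v i p, dirD u (dirD v (f i)) p = dirD v (dirD u (f i)) p := fun u v i p =>
    dirD_comm ((hf i).of_le (by norm_num)) u v p
  have hslice : ∀ s : ℝ, Continuous fun x : Fin 3 → ℝ => (s, x) := fun s => by fun_prop
  have hεc := hεsm.continuous
  have hdεc : ∀ i, Continuous (pd3 i ε) := fun i =>
    (hεsm.continuous_fderiv two_ne_zero).clm_apply continuous_const
  have hdt : ∀ s x i, dt3 E s x i = dirD timeDir (f i) (s, x) := fun s x i =>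
    (hasDerivAt_time (hf0 i) s x).deriv
  have hdtt : ∀ s x i, deriv (fun r => dt3 E r x i) s =
      dirD timeDir (dirD timeDir (f i)) (s, x) := fun s x i => by
    simp only [hdt]
    exact (hasDerivAt_time (hf1' _ i) s x).deriv
  have hpd : ∀ s x i j, pd3 j (fun y => E s y i) x = dirD (spaceDir j) (f i) (s, x) :=
    fun s x i j => pd3_slice (hf0 i) s x j
  have hdv : ∀ s x, div3 (E s) x = ∑ i, dirD (spaceDir i) (f i) (s, x) := fun s x => by
    simp only [div3, hpd]
  have hdvt : ∀ s x, div3 (fun y => dt3 E s y) x =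
      ∑ i, dirD (spaceDir i) (dirD timeDir (f i)) (s, x) := fun s x => by
    simp only [div3, hdt, pd3_slice (hf1' _ _)]
  have hcc : ∀ s x i, curl3 (fun y => curl3 (E s) y) x i =
      (dirD (spaceDir (i + 1)) (dirD (spaceDir (i + 2 + 1)) (f (i + 2 + 2))) (s, x)
        - dirD (spaceDir (i + 1)) (dirD (spaceDir (i + 2 + 2)) (f (i + 2 + 1))) (s, x))
      - (dirD (spaceDir (i + 2)) (dirD (spaceDir (i + 1 + 1)) (f (i + 1 + 2))) (s, x)
        - dirD (spaceDir (i + 2)) (dirD (spaceDir (i + 1 + 2)) (f (i + 1 + 1))) (s, x)) := by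
    intro s x i
    simp only [curl3, hpd]
    rw [← dirD_sub (hf1' _ _ _) (hf1' _ _ _), ← dirD_sub (hf1' _ _ _) (hf1' _ _ _),
      ← pd3_slice (by fun_prop), ← pd3_slice (by fun_prop)]
  have hdε : ∀ s x, div3 (fun y => ε y • E s y) x =
      ∑ i, (pd3 i ε x * f i (s, x) + ε x * dirD (spaceDir i) (f i) (s, x)) := by
    intro s x
    refine Finset.sum_congr rfl fun i _ => ?_
    have hEi : DifferentiableAt ℝ (fun y => E s y i) x :=
      ((hf0 i).comp (by fun_prop : Differentiable ℝ fun y : Fin 3 → ℝ => (s, y))) x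
    rw [← hpd]
    exact dirD_mul (hεsm.differentiable two_ne_zero x) hEi (Pi.single i 1)
  have hflux0 : ∀ j, ∀ x ∈ frontier Ω, energyFlux f j (t, x) = 0 := by
    intro j x hx
    have h : ∀ i, dirD timeDir (f i) (t, x) = 0 := fun i => by
      rw [← hdt]
      simp [dt3, hBC _ x hx]
    simp [energyFlux, h]
  have hfluxint : ∀ j, ∫ x in Ω, dirD (spaceDir j) (energyFlux f j) (t, x) = 0 := by
    intro j
    have h := setIntegral_fderiv_apply_eq_zero (μ := volume) hΩ
      ((contDiff_energyFlux hf j).comp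
        (by fun_prop : ContDiff ℝ 1 fun y : Fin 3 → ℝ => (t, y))) (hflux0 j) (Pi.single j 1)
    rw [← h]
    exact integral_congr_ae (.of_forall fun x =>
      (fderiv_space ((contDiff_energyFlux hf j).differentiable one_ne_zero) t x _).symm)
  have hfluxc : ∀ j, Continuous fun x => dirD (spaceDir j) (energyFlux f j) (t, x) := fun j =>
    ((contDiff_energyFlux hf j).dirD (m := 0) (by norm_num) _).continuous.comp (hslice t)
  let G : ℝ → (Fin 3 → ℝ) → ℝ := fun s x =>
    ε x * ∑ i, dirD timeDir (f i) (s, x) * dirD timeDir (dirD timeDir (f i)) (s, x)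
      + ∑ i, ∑ j, dirD (spaceDir j) (f i) (s, x) *
          dirD timeDir (dirD (spaceDir j) (f i)) (s, x)
      + (ε x - 1) * ((∑ i, dirD (spaceDir i) (f i) (s, x)) *
          ∑ i, dirD timeDir (dirD (spaceDir i) (f i)) (s, x))
  have hGc : Continuous fun p : ℝ × (Fin 3 → ℝ) => G p.1 p.2 := by
    simp only [G, Prod.mk.eta]
    fun_prop
  let R : (Fin 3 → ℝ) → ℝ := fun x =>
    (∑ i, pd3 i ε x * f i (t, x)) * ∑ i, dirD (spaceDir i) (dirD timeDir (f i)) (t, x)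
  have hfc : ∀ i, Continuous (f i) := fun i => (hf i).continuous
  have hRc : Continuous R := by fun_prop
  have hderiv := hasDerivAt_setIntegral_of_continuous (μ := volume) hΩ
    (F := fun s x => (ε x * ∑ i, (dirD timeDir (f i) (s, x)) ^ 2) / 2
          + (∑ i, ∑ j, (dirD (spaceDir j) (f i) (s, x)) ^ 2) / 2
          + ((ε x - 1) * (∑ i, dirD (spaceDir i) (f i) (s, x)) ^ 2) / 2)
    (F' := G) (fun s => by fun_prop) hGc (fun s x => by
      have h1 : ∀ u i, HasDerivAt (fun r => dirD u (f i) (r, x))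
          (dirD timeDir (dirD u (f i)) (s, x)) s := fun u i => hasDerivAt_time (hf1' u i) s x
      have h2 := (((HasDerivAt.fun_sum (u := Finset.univ) fun i _ =>
        (h1 timeDir i).fun_pow 2).const_mul (ε x)).div_const 2).add
        ((HasDerivAt.fun_sum (u := Finset.univ) fun i _ =>
          HasDerivAt.fun_sum (u := Finset.univ) fun j _ =>
            (h1 (spaceDir j) i).fun_pow 2).div_const 2) |>.add
        ((((HasDerivAt.fun_sum (u := Finset.univ) fun i _ =>
          h1 (spaceDir i) i).fun_pow 2).const_mul (ε x - 1)).div_const 2)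
      refine h2.congr_deriv ?_
      simp only [G, Fin.sum_univ_three]
      push_cast
      ring) t
  have hpoint : Set.EqOn (G t)
      (fun x => ∑ j, dirD (spaceDir j) (energyFlux f j) (t, x) - R x) Ω := by
    intro x hx
    have hp0 := hPDE t x hx 0
    have hp1 := hPDE t x hx 1
    have hp2 := hPDE t x hx 2
    have hd := hdiv t x hx
    rw [hdε] at hd
    rw [hdtt, hcc] at hp0 hp1 hp2
    simp only [G, R, dirD_energyFlux hf, hcomm timeDir (spaceDir _)]
    simp only [Fin.sum_univ_three] at hd ⊢
    simp only [Fin.isValue, Fin.reduceAdd] at hp0 hp1 hp2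
    simp only [hcomm (spaceDir 1) (spaceDir 0), hcomm (spaceDir 2) (spaceDir 0),
      hcomm (spaceDir 2) (spaceDir 1)] at hp0 hp1 hp2 ⊢
    linear_combination dirD timeDir (f 0) (t, x) * hp0 + dirD timeDir (f 1) (t, x) * hp1
      + dirD timeDir (f 2) (t, x) * hp2
      + (dirD (spaceDir 0) (dirD timeDir (f 0)) (t, x)
        + dirD (spaceDir 1) (dirD timeDir (f 1)) (t, x)
        + dirD (spaceDir 2) (dirD timeDir (f 2)) (t, x)) * hd
  have hGt : Continuous (G t) := hGc.comp (hslice t)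
  have hvalue : ∫ x in Ω, G t x = -∫ x in Ω, R x := by
    rw [setIntegral_congr_of_continuous hGt
      ((continuous_finsetSum _ fun j _ => hfluxc j).fun_sub hRc) hpoint,
      integral_sub (integrableOn_of_continuous_of_isBounded hΩ
        (continuous_finsetSum _ fun j _ => hfluxc j))
        (integrableOn_of_continuous_of_isBounded hΩ hRc),
      integral_finsetSum _ fun j _ => integrableOn_of_continuous_of_isBounded hΩ (hfluxc j)]
    simp [hfluxint]
  rw [hvalue] at hderiv
  simpa only [hdt, hpd, hdv, hdvt] using hderiv
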